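/- arXiv:2408.11591 — 8 statements merged into one kernel-verified Lean document; each statement's English description precedes it below -/
import Mathlib

section
/- For every r ≥ 2 there exists a coloring c : {1, ..., 2^(2^r)} → Fin r such that there are no positive integers a, b, x, y with x ≥ 2, y ≥ 2, a + b = x * y, all of a, b, a + b, x, y lying in {1, ..., 2^(2^r)}, and c assigning the same color to a, b, a + b, x, and y. In particular, the Ramsey number H(r) for the configuration {a, b, a+b, x, y, xy} with x, y ≥ 2 satisfies H(r) > 2^(2^r). -/
/-- The doubly logarithmic level of a product exceeds that of factors lying on a common level. -/
lemma log_log_lt_log_log_mul {x y : ℕ} (hx : 2 ≤ x) (hy : 2 ≤ y)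
    (h : Nat.log 2 (Nat.log 2 x) = Nat.log 2 (Nat.log 2 y)) :
    Nat.log 2 (Nat.log 2 x) < Nat.log 2 (Nat.log 2 (x * y)) := by
  have hlx : Nat.log 2 x ≠ 0 := (Nat.log_pos one_lt_two hx).ne'
  have hly : Nat.log 2 y ≠ 0 := (Nat.log_pos one_lt_two hy).ne'
  have hxy : Nat.log 2 x + Nat.log 2 y ≤ Nat.log 2 (x * y) := by
    apply Nat.le_log_of_pow_le one_lt_two
    rw [pow_add]
    exact Nat.mul_le_mul (Nat.pow_log_le_self 2 (by omega)) (Nat.pow_log_le_self 2 (by omega))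
  have h1 := Nat.pow_log_le_self 2 hlx
  have h2 := Nat.pow_log_le_self 2 hly
  rw [← h] at h2
  apply Nat.le_log_of_pow_le one_lt_two
  rw [pow_succ]
  omega

/-- A number below `2 ^ (2 ^ r)` has doubly logarithmic level below `r`. -/
lemma log_log_lt {x r : ℕ} (hx : 2 ≤ x) (h : x < 2 ^ (2 ^ r)) :
    Nat.log 2 (Nat.log 2 x) < r :=
  Nat.log_lt_of_lt_pow (Nat.log_pos one_lt_two hx).ne' (Nat.log_lt_of_lt_pow (by omega) h)

/-- Coloring by the doubly logarithmic level modulo `r` leaves no monochromatic multiplicative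
Schur triple in `{2, ..., 2 ^ (2 ^ r)}`. -/
lemma not_monochromatic_mul {r x y : ℕ} (hr : 2 ≤ r) (hx : 2 ≤ x) (hy : 2 ≤ y)
    (hN : x * y ≤ 2 ^ (2 ^ r))
    (h1 : Nat.log 2 (Nat.log 2 (x * y)) % r = Nat.log 2 (Nat.log 2 x) % r)
    (h2 : Nat.log 2 (Nat.log 2 (x * y)) % r = Nat.log 2 (Nat.log 2 y) % r) : False := by
  have hLx : Nat.log 2 (Nat.log 2 x) < r := log_log_lt hx (by nlinarith)
  have hLy : Nat.log 2 (Nat.log 2 y) < r := log_log_lt hy (by nlinarith)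
  rw [Nat.mod_eq_of_lt hLx] at h1
  rw [Nat.mod_eq_of_lt hLy] at h2
  have hlt := log_log_lt_log_log_mul hx hy (h1.symm.trans h2)
  have hle : Nat.log 2 (Nat.log 2 (x * y)) ≤ r := by
    calc Nat.log 2 (Nat.log 2 (x * y)) ≤ Nat.log 2 (Nat.log 2 (2 ^ (2 ^ r))) :=
          Nat.log_mono_right (Nat.log_mono_right hN)
      _ = r := by rw [Nat.log_pow one_lt_two, Nat.log_pow one_lt_two]
  rcases hle.lt_or_eq with h | h
  · rw [Nat.mod_eq_of_lt h] at h1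
    omega
  · rw [h, Nat.mod_self] at h1 h2
    have small : ∀ z, Nat.log 2 (Nat.log 2 z) = 0 → z < 4 := by
      intro z hz
      have hz' : Nat.log 2 z < 2 := by
        simpa [hz] using Nat.lt_pow_succ_log_self one_lt_two (Nat.log 2 z)
      exact Nat.lt_pow_of_log_lt one_lt_two hz'
    have hx4 := small x h1.symm
    have hy4 := small y h2.symm
    have : Nat.log 2 (Nat.log 2 (x * y)) < 2 := log_log_lt (by nlinarith) (by norm_num; nlinarith)
    omega


/-- For `r ≥ 2` there is an `r`-coloring of `{1, ..., 2^(2^r)}` with no monochromatic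
configuration `{a, b, a+b, x, y, xy}` with `a + b = x * y` and `x, y ≥ 2`;
hence `H(r) > 2^(2^r)`. -/
theorem stmt_1 (r : ℕ) (hr : 2 ≤ r) :
    ∃ c : ℕ → Fin r,
      ¬ ∃ a b x y : ℕ, 0 < a ∧ 0 < b ∧ 2 ≤ x ∧ 2 ≤ y ∧
        a + b = x * y ∧
        a ≤ 2 ^ (2 ^ r) ∧ b ≤ 2 ^ (2 ^ r) ∧ a + b ≤ 2 ^ (2 ^ r) ∧
        x ≤ 2 ^ (2 ^ r) ∧ y ≤ 2 ^ (2 ^ r) ∧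
        c a = c b ∧ c a = c (a + b) ∧ c a = c x ∧ c a = c y := by
  refine ⟨fun n => ⟨Nat.log 2 (Nat.log 2 n) % r, Nat.mod_lt _ (by omega)⟩, ?_⟩
  rintro ⟨a, b, x, y, -, -, hx, hy, hab, -, -, hN, -, -, -, hs, hcx, hcy⟩
  rw [hab] at hN hs
  exact not_monochromatic_mul hr hx hy hN
    (Fin.mk.inj (hs.symm.trans hcx)) (Fin.mk.inj (hs.symm.trans hcy))
end

section
/- Let r, m, n ≥ 1 and let M, N be positive integers with the following Ramsey properties: every coloring of the unordered pairs from {1, ..., M} with r colors admits m+1 indices all of whose pairs receive the same color, and every coloring of the unordered pairs from {1, ..., N} with r^M colors admits n+1 indices all of whose pairs receive the same color. Then for every coloring c : {1, ..., N^M} → Fin r there exist positive integers a_1, ..., a_n and x_1, ..., x_m with a_1 + ... + a_n = x_1 * ... * x_m, such that all of a_1, ..., a_n, x_1, ..., x_m, and the common value a_1 + ... + a_n = x_1 * ... * x_m lie in {1, ..., N^M} and receive the same color under c. -/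
/-- Products over consecutive intervals telescope. -/
@[to_additive /-- Sums over consecutive intervals telescope. -/]
theorem Fin.prod_prod_Ico_castSucc_succ {α : Type*} [CommMonoid α] (D : ℕ → α) :
    ∀ {k : ℕ} {e : Fin (k + 1) → ℕ}, Monotone e →
      ∏ j : Fin k, ∏ l ∈ Finset.Ico (e j.castSucc) (e j.succ), D l =
        ∏ l ∈ Finset.Ico (e 0) (e (Fin.last k)), D l
  | 0, e, _ => by simp
  | k + 1, e, he => by
    have ih := Fin.prod_prod_Ico_castSucc_succ D (e := e ∘ Fin.castSucc)
      (he.comp Fin.strictMono_castSucc.monotone)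
    rw [Fin.prod_univ_castSucc]
    simp only [Function.comp_apply, Fin.castSucc_zero, ← Fin.succ_castSucc] at ih ⊢
    rw [ih, Fin.succ_last,
      Finset.prod_Ico_consecutive _ (he (Fin.zero_le _)) (he (Fin.le_last _))]

/-- The gaps of a monotone sequence add up to the difference of its ends. -/
theorem Fin.sum_succ_sub_castSucc {k : ℕ} {e : Fin (k + 1) → ℕ} (he : Monotone e) :
    ∑ j : Fin k, (e j.succ - e j.castSucc) = e (Fin.last k) - e 0 := by
  simpa using Fin.sum_sum_Ico_castSucc_succ (fun _ => (1 : ℕ)) he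

/-- A homogeneous set for a coloring of pairs, listed in increasing order. -/
theorem exists_strictMono_homogeneous {κ : Type*} {P k : ℕ} {f : ℕ → ℕ → κ}
    (h : ∃ T : Finset ℕ, T ⊆ Finset.Icc 1 P ∧ T.card = k ∧
      ∀ i ∈ T, ∀ j ∈ T, ∀ i' ∈ T, ∀ j' ∈ T, i < j → i' < j' → f i j = f i' j') :
    ∃ e : Fin k → ℕ, StrictMono e ∧ (∀ i, e i ≤ P) ∧
      ∀ i j i' j', i < j → i' < j' → f (e i) (e j) = f (e i') (e j') := by
  obtain ⟨T, hT, hk, hf⟩ := h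
  have hmem := T.orderEmbOfFin_mem hk
  refine ⟨T.orderEmbOfFin hk, (T.orderEmbOfFin hk).strictMono,
    fun i => (Finset.mem_Icc.1 (hT (hmem i))).2, fun i j i' j' hij hij' => ?_⟩
  exact hf _ (hmem i) _ (hmem j) _ (hmem i') _ (hmem j')
    ((T.orderEmbOfFin hk).strictMono hij) ((T.orderEmbOfFin hk).strictMono hij')

/-- The Ramsey property for `r ^ M` colors gives `n` positive integers whose dilates by each of
`M` given factors are monochromatic together with the dilate of their sum. -/
theorem exists_sum_dilates_monochromatic {r n M N : ℕ} (hn : 1 ≤ n)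
    (hRamsey : ∀ f : ℕ → ℕ → Fin (r ^ M), ∃ T : Finset ℕ,
      T ⊆ Finset.Icc 1 N ∧ T.card = n + 1 ∧
      ∀ i ∈ T, ∀ j ∈ T, ∀ i' ∈ T, ∀ j' ∈ T, i < j → i' < j' → f i j = f i' j')
    (c : ℕ → Fin r) (s : ℕ → ℕ) :
    ∃ d : Fin n → ℕ, (∀ i, 0 < d i) ∧ ∑ i, d i ≤ N ∧
      ∀ k < M, ∀ i, c (d i * s k) = c ((∑ i, d i) * s k) := by
  obtain ⟨e, he, heN, hf⟩ := exists_strictMono_homogeneous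
    (hRamsey fun i j => finFunctionFinEquiv fun k : Fin M => c ((j - i) * s k))
  refine ⟨fun i => e i.succ - e i.castSucc,
    fun i => Nat.sub_pos_of_lt (he i.castSucc_lt_succ), ?_, fun k hk i => ?_⟩
  · rw [Fin.sum_succ_sub_castSucc he.monotone]
    exact (Nat.sub_le _ _).trans (heN _)
  · rw [Fin.sum_succ_sub_castSucc he.monotone]
    have hlast : (0 : Fin (n + 1)) < Fin.last n := by
      rw [Fin.lt_def]
      exact hn
    exact congrFun (finFunctionFinEquiv.injective
      (hf _ _ _ _ i.castSucc_lt_succ hlast)) ⟨k, hk⟩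

/-- A sequence may be built so that each term satisfies a solvable condition depending on the
products `∏ l ∈ Finset.Ico k t, D l` of the values already attached to the earlier terms. -/
theorem exists_seq_of_forall_partial_prod {β : Type*} (v : β → ℕ) {p : (ℕ → ℕ) → β → Prop}
    (h : ∀ s, ∃ b, p s b) :
    ∃ g : ℕ → β, ∀ t, p (fun k => ∏ l ∈ Finset.Ico k t, v (g l)) (g t) := by
  choose F hF using h
  let S : ℕ → ℕ → ℕ := fun t =>
    Nat.rec (fun _ => 1) (fun t s k => if k ≤ t then s k * v (F s) else 1) t
  have hS : ∀ t, S t = fun k => ∏ l ∈ Finset.Ico k t, v (F (S l)) := by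
    intro t
    induction t with
    | zero => ext k; simp [S]
    | succ t ih =>
      ext k
      change (if k ≤ t then S t k * v (F (S t)) else 1) = _
      split_ifs with hk
      · rw [Finset.prod_Ico_succ_top hk, ← congrFun ih k]
      · rw [Finset.Ico_eq_empty (by omega), Finset.prod_empty]
  refine ⟨fun t => F (S t), fun t => ?_⟩
  rw [← hS t]
  exact hF _


/-- If `M` has the `(m+1; r)`-Ramsey property for pairs and `N` has the
`(n+1; r^M)`-Ramsey property for pairs, then any `r`-coloring of `{1, ..., N^M}`
contains a monochromatic set `{a_1, ..., a_n, ∑ a_i, x_1, ..., x_m, ∏ x_j}`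
with `∑ a_i = ∏ x_j`. -/
theorem stmt_2 (r m n M N : ℕ) (hr : 1 ≤ r) (hm : 1 ≤ m) (hn : 1 ≤ n)
    (hM : 0 < M) (hN : 0 < N)
    (hRamseyM : ∀ f : ℕ → ℕ → Fin r, ∃ T : Finset ℕ,
      T ⊆ Finset.Icc 1 M ∧ T.card = m + 1 ∧
      ∀ i ∈ T, ∀ j ∈ T, ∀ i' ∈ T, ∀ j' ∈ T, i < j → i' < j' → f i j = f i' j')
    (hRamseyN : ∀ f : ℕ → ℕ → Fin (r ^ M), ∃ T : Finset ℕ,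
      T ⊆ Finset.Icc 1 N ∧ T.card = n + 1 ∧
      ∀ i ∈ T, ∀ j ∈ T, ∀ i' ∈ T, ∀ j' ∈ T, i < j → i' < j' → f i j = f i' j')
    (c : ℕ → Fin r) :
    ∃ (a : Fin n → ℕ) (x : Fin m → ℕ),
      (∀ i, 0 < a i) ∧ (∀ j, 0 < x j) ∧
      (∑ i, a i) = (∏ j, x j) ∧
      (∀ i, a i ≤ N ^ M) ∧ (∀ j, x j ≤ N ^ M) ∧ (∑ i, a i) ≤ N ^ M ∧
      (∀ i, c (a i) = c (∑ i, a i)) ∧ (∀ j, c (x j) = c (∑ i, a i)) := by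
  obtain ⟨d, hd⟩ := exists_seq_of_forall_partial_prod (fun d : Fin n → ℕ => ∑ i, d i)
    (exists_sum_dilates_monochromatic hn hRamseyN c)
  set D : ℕ → ℕ := fun t => ∑ i, d t i
  have hDpos (t : ℕ) : 0 < D t :=
    Finset.sum_pos (fun i _ => (hd t).1 i) ⟨⟨0, hn⟩, Finset.mem_univ _⟩
  have hPpos (u v : ℕ) : 0 < ∏ l ∈ Finset.Ico u v, D l := Finset.prod_pos fun l _ => hDpos l
  have hPle (u v : ℕ) (hv : v ≤ M) : ∏ l ∈ Finset.Ico u v, D l ≤ N ^ M := by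
    refine (Finset.prod_le_pow_card _ _ N fun l _ => (hd l).2.1).trans ?_
    rw [Nat.card_Ico]
    exact Nat.pow_le_pow_right hN (by omega)
  obtain ⟨e, he, heM, hf⟩ := exists_strictMono_homogeneous
    (hRamseyM fun i j => c (∏ l ∈ Finset.Ico i j, D l))
  have hlast : (0 : Fin (m + 1)) < Fin.last m := by
    rw [Fin.lt_def]
    exact hm
  obtain ⟨w, hw⟩ : ∃ w, e (Fin.last m) = w + 1 :=
    Nat.exists_eq_succ_of_ne_zero (Nat.ne_zero_of_lt (he hlast))
  have huw : e 0 ≤ w := by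
    have := he hlast
    omega
  have hwM : w + 1 ≤ M := hw ▸ heM _
  have hsum : ∑ i, d w i * ∏ l ∈ Finset.Ico (e 0) w, D l =
      ∏ l ∈ Finset.Ico (e 0) (e (Fin.last m)), D l := by
    rw [hw, Finset.prod_Ico_succ_top huw, ← Finset.sum_mul, mul_comm]
  refine ⟨fun i => d w i * ∏ l ∈ Finset.Ico (e 0) w, D l,
    fun j => ∏ l ∈ Finset.Ico (e j.castSucc) (e j.succ), D l,
    fun i => Nat.mul_pos ((hd w).1 i) (hPpos _ _), fun j => hPpos _ _, ?_, fun i => ?_,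
    fun j => hPle _ _ (heM _), ?_, fun i => ?_, fun j => ?_⟩
  · rw [hsum, Fin.prod_prod_Ico_castSucc_succ D he.monotone]
  · refine le_trans ?_ (hPle (e 0) _ (heM (Fin.last m)))
    rw [← hsum]
    exact Finset.single_le_sum
      (f := fun i => d w i * ∏ l ∈ Finset.Ico (e 0) w, D l) (fun _ _ => Nat.zero_le _)
      (Finset.mem_univ i)
  · exact hsum ▸ hPle _ _ (heM _)
  · rw [← Finset.sum_mul]
    exact (hd w).2.2 (e 0) (by omega) i
  · rw [hsum]
    exact hf _ _ _ _ j.castSucc_lt_succ hlast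
end

section
/- Let r, n, M ≥ 1 and let N be a positive integer such that every coloring of the unordered pairs from {1, ..., N} with r^M colors admits n+1 indices all of whose pairs receive the same color. Then for every coloring c : {1, ..., N^M} → Fin r there exist, for each k ∈ {1, ..., M}, positive integers s_{k,1}, ..., s_{k,n} (with distinguished element s_k := s_{k,1}) such that, writing s_{i,j} := s_i * s_{i+1} * ... * s_{j-1} for i ≤ j (empty product equal to 1), for all 1 ≤ i ≤ j ≤ M and every t in the list s_{j,1}, ..., s_{j,n}, s_{j,1} + ... + s_{j,n}, the product s_{i,j} * t lies in {1, ..., N^M} and the color c(s_{i,j} * t) depends only on the pair (i, j) and not on the choice of t. -/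
theorem sum_Icc_tsub_pred (a : ℕ → ℕ) (m : ℕ) (ha : ∀ l < m, a l ≤ a (l + 1)) :
    a 0 ≤ a m ∧ ∑ l ∈ Finset.Icc 1 m, (a l - a (l - 1)) = a m - a 0 := by
  induction m with
  | zero => simp
  | succ m ih =>
    obtain ⟨h0, h1⟩ := ih fun l hl => ha l (by omega)
    have h2 := ha m (by omega)
    refine ⟨h0.trans h2, ?_⟩
    rw [Finset.sum_Icc_succ_top (by omega), h1, Nat.add_sub_cancel]
    omega

/-- Simultaneous Schur-type lemma: applying the Ramsey property to differences, one finds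
`s 1, ..., s n` such that for each of the `M` multipliers `p 1, ..., p M`, the multiples of
the `s l` and of their sum all receive the same color. -/
theorem exists_monochromatic_multiples {r n M N : ℕ} (hn : 1 ≤ n)
    (hRamseyN : ∀ f : ℕ → ℕ → Fin (r ^ M), ∃ T : Finset ℕ,
      T ⊆ Finset.Icc 1 N ∧ T.card = n + 1 ∧
      ∀ i ∈ T, ∀ j ∈ T, ∀ i' ∈ T, ∀ j' ∈ T, i < j → i' < j' → f i j = f i' j')
    (c : ℕ → Fin r) (p : ℕ → ℕ) :
    ∃ s : ℕ → ℕ, (∀ l ∈ Finset.Icc 1 n, 0 < s l ∧ s l ≤ N) ∧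
      ∑ l ∈ Finset.Icc 1 n, s l ≤ N ∧
      ∀ i ∈ Finset.Icc 1 M, (∀ l ∈ Finset.Icc 1 n, c (p i * s l) = c (p i * s 1)) ∧
        c (p i * ∑ l ∈ Finset.Icc 1 n, s l) = c (p i * s 1) := by
  obtain ⟨T, hT, hcard, hmono⟩ := hRamseyN fun a b =>
    finFunctionFinEquiv fun i : Fin M => c (p (i + 1) * (b - a))
  obtain ⟨a, haT, hlt⟩ : ∃ a : ℕ → ℕ, (∀ l ≤ n, a l ∈ T) ∧
      ∀ l m, l < m → m ≤ n → a l < a m := by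
    refine ⟨fun l => if h : l < n + 1 then T.orderEmbOfFin hcard ⟨l, h⟩ else 0, ?_, ?_⟩
    · intro l hl
      simp only [dif_pos (Nat.lt_succ_of_le hl)]
      exact T.orderEmbOfFin_mem hcard _
    · intro l m hlm hm
      simp only [dif_pos (Nat.lt_succ_of_le hm),
        dif_pos (Nat.lt_succ_of_le (hlm.le.trans hm))]
      exact (T.orderEmbOfFin hcard).strictMono hlm
  have hle : ∀ l ≤ n, a l ≤ N := fun l hl => (Finset.mem_Icc.1 (hT (haT l hl))).2
  have hsum := (sum_Icc_tsub_pred a n fun l hl => (hlt l (l + 1) (by omega) hl).le).2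
  have key : ∀ i ∈ Finset.Icc 1 M, ∀ l m, l < m → m ≤ n →
      c (p i * (a m - a l)) = c (p i * (a 1 - a 0)) := by
    intro i hi l m hlm hm
    rw [Finset.mem_Icc] at hi
    have h := finFunctionFinEquiv.injective (hmono _ (haT l (by omega)) _ (haT m hm)
      _ (haT 0 (by omega)) _ (haT 1 hn) (hlt l m hlm hm) (hlt 0 1 one_pos hn))
    have h' := congrFun h ⟨i - 1, by omega⟩
    simpa only [Nat.sub_add_cancel hi.1] using h'
  refine ⟨fun l => a l - a (l - 1), ?_, ?_, ?_⟩
  · intro l hl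
    rw [Finset.mem_Icc] at hl
    have h1 := hlt (l - 1) l (by omega) hl.2
    have h2 := hle l hl.2
    simp only
    omega
  · rw [hsum]
    exact (Nat.sub_le _ _).trans (hle n le_rfl)
  · intro i hi
    refine ⟨fun l hl => ?_, ?_⟩
    · rw [Finset.mem_Icc] at hl
      exact key i hi _ _ (by omega) hl.2
    · rw [hsum]
      exact key i hi 0 n hn le_rfl

/-- A sequence may be defined recursively by prescribing each term as a function of the
products over the intervals of earlier terms. -/
theorem exists_seq_of_interval_products {α : Type*} (φ : α → ℕ) (g : (ℕ → ℕ) → α) :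
    ∃ S : ℕ → α, ∀ j, S j = g fun i => ∏ k ∈ Finset.Ico i j, φ (S k) := by
  let Q : ℕ → ℕ → ℕ := fun j => Nat.rec (fun _ => 1)
    (fun j q i => if i ≤ j then q i * φ (g q) else 1) j
  have hQ : ∀ j i, Q j i = ∏ k ∈ Finset.Ico i j, φ (g (Q k)) := by
    intro j
    induction j with
    | zero => intro i; simp [Q]
    | succ j ih =>
      intro i
      have hstep : Q (j + 1) i = if i ≤ j then Q j i * φ (g (Q j)) else 1 := rfl
      rw [hstep]
      split_ifs with h
      · rw [Finset.prod_Ico_succ_top h, ih]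
      · rw [Finset.Ico_eq_empty (by omega), Finset.prod_empty]
  exact ⟨fun j => g (Q j), fun j => congrArg g (funext (hQ j))⟩

/-- Key lemma: if `N` has the `(n+1; r^M)`-Ramsey property for pairs, then for every
`r`-coloring `c` of `{1, ..., N^M}` there are, for each `k ∈ {1, ..., M}`, positive
integers `S k 1, ..., S k n` (with distinguished element `s_k = S k 1`) such that,
writing `P i j = s_i * s_{i+1} * ... * s_{j-1}` for `i ≤ j`, for all `1 ≤ i ≤ j ≤ M`
the products `P i j * t` for `t ∈ {S j 1, ..., S j n, S j 1 + ... + S j n}` lie in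
`{1, ..., N^M}` and all receive the same color under `c`. -/
theorem stmt_3 (r n M N : ℕ) (hr : 1 ≤ r) (hn : 1 ≤ n) (hM : 1 ≤ M) (hN : 0 < N)
    (hRamseyN : ∀ f : ℕ → ℕ → Fin (r ^ M), ∃ T : Finset ℕ,
      T ⊆ Finset.Icc 1 N ∧ T.card = n + 1 ∧
      ∀ i ∈ T, ∀ j ∈ T, ∀ i' ∈ T, ∀ j' ∈ T, i < j → i' < j' → f i j = f i' j')
    (c : ℕ → Fin r) :
    ∃ S : ℕ → ℕ → ℕ,
      (∀ k ∈ Finset.Icc 1 M, ∀ l ∈ Finset.Icc 1 n, 0 < S k l) ∧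
      ∀ i j, 1 ≤ i → i ≤ j → j ≤ M →
        ((∀ l ∈ Finset.Icc 1 n,
            (∏ k ∈ Finset.Ico i j, S k 1) * S j l ≤ N ^ M ∧
            c ((∏ k ∈ Finset.Ico i j, S k 1) * S j l) =
              c ((∏ k ∈ Finset.Ico i j, S k 1) * S j 1)) ∧
          (∏ k ∈ Finset.Ico i j, S k 1) * (∑ l ∈ Finset.Icc 1 n, S j l) ≤ N ^ M ∧
          c ((∏ k ∈ Finset.Ico i j, S k 1) * (∑ l ∈ Finset.Icc 1 n, S j l)) =
            c ((∏ k ∈ Finset.Ico i j, S k 1) * S j 1)) := by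
  choose g hg using exists_monochromatic_multiples hn hRamseyN c
  obtain ⟨S, hS⟩ := exists_seq_of_interval_products (fun s : ℕ → ℕ => s 1) g
  have hbound : ∀ k, ∀ l ∈ Finset.Icc 1 n, 0 < S k l ∧ S k l ≤ N := fun k => by
    rw [hS k]
    exact (hg _).1
  have hprod : ∀ i j t, 1 ≤ i → i ≤ j → j ≤ M → t ≤ N →
      (∏ k ∈ Finset.Ico i j, S k 1) * t ≤ N ^ M := by
    intro i j t hi hij hj ht
    have h : ∏ k ∈ Finset.Ico i j, S k 1 ≤ N ^ (j - i) := by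
      simpa using Finset.prod_le_pow_card (Finset.Ico i j) (fun k => S k 1) N
        fun k _ => (hbound k 1 (Finset.mem_Icc.2 ⟨le_rfl, hn⟩)).2
    calc (∏ k ∈ Finset.Ico i j, S k 1) * t ≤ N ^ (j - i) * N := Nat.mul_le_mul h ht
      _ = N ^ (j - i + 1) := (pow_succ _ _).symm
      _ ≤ N ^ M := Nat.pow_le_pow_right hN (by omega)
  refine ⟨S, fun k _ l hl => (hbound k l hl).1, fun i j hi hij hj => ?_⟩
  obtain ⟨-, hsum, hcol⟩ := hg fun i => ∏ k ∈ Finset.Ico i j, S k 1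
  rw [← hS j] at hsum hcol
  obtain ⟨hcol_term, hcol_sum⟩ := hcol i (Finset.mem_Icc.2 ⟨hi, hij.trans hj⟩)
  exact ⟨fun l hl => ⟨hprod i j _ hi hij hj (hbound j l hl).2, hcol_term l hl⟩,
    hprod i j _ hi hij hj hsum, hcol_sum⟩
end

section
/- For every r ≥ 1 and every coloring c : ℕ+ → Fin r of the positive integers with finitely many colors, there exist positive integers a, b, x, y with a + b = x * y such that c(a) = c(b) = c(a + b) = c(x) = c(y), i.e., the set {a, b, a+b, x, y, xy} is monochromatic. -/
attribute [local instance] Ultrafilter.semigroup Ultrafilter.addSemigroup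

/-- The image of an idempotent ultrafilter under an additive map is idempotent. -/
theorem Ultrafilter.map_add_self_eq {M N : Type*} [AddSemigroup M] [AddSemigroup N] (f : M → N)
    (hf : ∀ a b, f (a + b) = f a + f b) {e : Ultrafilter M} (he : e + e = e) :
    e.map f + e.map f = e.map f := by
  refine Ultrafilter.coe_inj.mp (Filter.ext' fun p => ?_)
  rw [Ultrafilter.eventually_add]
  simp only [Ultrafilter.coe_map, Filter.eventually_map, ← hf]
  rw [← Ultrafilter.eventually_add e e (fun m => p (f m)), he]

/-- If `A` belongs to an additively idempotent ultrafilter, so does the set of elements of `A`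
that are sums of two elements of `A`. -/
theorem Ultrafilter.sums_mem_of_add_self_eq {M : Type*} [AddSemigroup M] {e : Ultrafilter M}
    (he : e + e = e) {A : Set M} (hA : A ∈ e) :
    {n | n ∈ A ∧ ∃ a ∈ A, ∃ b ∈ A, a + b = n} ∈ e := by
  have hsum : ∀ᶠ n in (e : Filter M), ∃ a ∈ A, ∃ b ∈ A, a + b = n := by
    rw [← he, Ultrafilter.eventually_add]
    filter_upwards [hA] with a ha
    filter_upwards [hA] with b hb
    exact ⟨a, ha, b, hb, rfl⟩
  exact Filter.inter_mem hA hsum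

/-- An ultrafilter in the closure of a set `S` has each of its members in some element of `S`. -/
theorem Ultrafilter.mem_closure_iff_forall_exists {α : Type*} {S : Set (Ultrafilter α)}
    {p : Ultrafilter α} : p ∈ closure S ↔ ∀ A ∈ p, ∃ e ∈ S, A ∈ e := by
  rw [ultrafilterBasis_is_basis.mem_closure_iff]
  constructor
  · intro h A hA
    obtain ⟨e, heA, heS⟩ := h {u | A ∈ u} ⟨A, rfl⟩ hA
    exact ⟨e, heS, heA⟩
  · rintro h _ ⟨A, rfl⟩ hA
    obtain ⟨e, heS, heA⟩ := h A hA
    exact ⟨e, heA, heS⟩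

/-- Some multiplicatively idempotent ultrafilter on `ℕ+` lies in the closure of the set of
additively idempotent ultrafilters. -/
theorem exists_mul_idempotent_mem_closure_add_idempotents :
    ∃ p ∈ closure {e : Ultrafilter ℕ+ | e + e = e}, p * p = p := by
  refine exists_idempotent_in_compact_subsemigroup Ultrafilter.continuous_mul_left _ ?_
    isClosed_closure.isCompact ?_
  · obtain ⟨e, he⟩ := exists_idempotent_of_compact_t2_of_continuous_add_left
      (Ultrafilter.continuous_add_left (M := ℕ+))
    exact ⟨e, subset_closure he⟩
  · intro p _ q hq
    rw [Ultrafilter.mem_closure_iff_forall_exists] at hq ⊢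
    intro A hA
    have hmul : ∀ᶠ m in (p : Filter ℕ+), ∀ᶠ n in (q : Filter ℕ+), m * n ∈ A :=
      (Ultrafilter.eventually_mul p q (· ∈ A)).mp hA
    obtain ⟨m, hm⟩ := hmul.exists
    obtain ⟨e, he, hmem⟩ := hq _ hm
    exact ⟨e.map (m * ·), Ultrafilter.map_add_self_eq _ (mul_add m) he, hmem⟩

/-- Any finite coloring of the positive integers contains a monochromatic set
`{a, b, a+b, x, y, xy}` with `a + b = x * y`. -/
theorem stmt_5 (r : ℕ) (hr : 1 ≤ r) (c : ℕ+ → Fin r) :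
    ∃ a b x y : ℕ+, a + b = x * y ∧
      c a = c b ∧ c b = c (a + b) ∧ c (a + b) = c x ∧ c x = c y := by
  obtain ⟨p, hp, hpp⟩ := exists_mul_idempotent_mem_closure_add_idempotents
  rw [Ultrafilter.mem_closure_iff_forall_exists] at hp
  obtain ⟨k, hk⟩ := (p.map c).eq_pure_of_finite
  have hA : c ⁻¹' {k} ∈ p := by
    rw [← Ultrafilter.mem_map, hk]
    exact Ultrafilter.mem_pure.mpr rfl
  set A := c ⁻¹' {k}
  have hB : {n | n ∈ A ∧ ∃ a ∈ A, ∃ b ∈ A, a + b = n} ∈ p := by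
    by_contra hB
    obtain ⟨e, he, hmem⟩ := hp _ (Filter.inter_mem hA (Ultrafilter.compl_mem_iff_notMem.mpr hB))
    have hsums := Ultrafilter.sums_mem_of_add_self_eq he (Filter.mem_of_superset hmem
      Set.inter_subset_left)
    exact Ultrafilter.compl_mem_iff_notMem.mp
      (Filter.mem_of_superset hmem Set.inter_subset_right) hsums
  have hprod : ∀ᶠ x in (p : Filter ℕ+), ∀ᶠ y in (p : Filter ℕ+),
      x * y ∈ {n | n ∈ A ∧ ∃ a ∈ A, ∃ b ∈ A, a + b = n} := by
    rw [← Ultrafilter.eventually_mul p p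
      (· ∈ {n | n ∈ A ∧ ∃ a ∈ A, ∃ b ∈ A, a + b = n}), hpp]
    exact hB
  obtain ⟨x, hx, hxA⟩ := (hprod.and hA).exists
  obtain ⟨y, ⟨hxy, a, ha, b, hb, hab⟩, hyA⟩ := (hx.and hA).exists
  have hcol : ∀ n ∈ A, c n = k := fun n hn => hn
  refine ⟨a, b, x, y, hab, ?_, ?_, ?_, ?_⟩
  · rw [hcol a ha, hcol b hb]
  · rw [hab, hcol b hb, hcol _ hxy]
  · rw [hab, hcol _ hxy, hcol x hxA]
  · rw [hcol x hxA, hcol y hyA]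
end

section
/- For all positive integers r, m, n and every coloring c : ℕ+ → Fin r of the positive integers, there exist positive integers a_1, ..., a_n and x_1, ..., x_m with a_1 + ... + a_n = x_1 * ... * x_m such that all of a_1, ..., a_n, x_1, ..., x_m, and the common value a_1 + ... + a_n = x_1 * ... * x_m receive the same color under c. -/
open Filter

attribute [local instance] Ultrafilter.mul Ultrafilter.add Ultrafilter.semigroup
  Ultrafilter.addSemigroup

/-- Every member of an idempotent ultrafilter contains `k + 1` elements together with their
product, where products are computed in a commutative monoid receiving a homomorphism from `M`. -/
@[to_additive]
theorem Ultrafilter.exists_prod_mem_of_mul_self {M N : Type*} [Semigroup M] [CommMonoid N]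
    (f : M →ₙ* N) {U : Ultrafilter M} (hU : U * U = U) (k : ℕ) {A : Set M} (hA : A ∈ U) :
    ∃ (x : Fin (k + 1) → M) (s : M), (∀ i, x i ∈ A) ∧ s ∈ A ∧ f s = ∏ i, f (x i) := by
  induction k generalizing A with
  | zero =>
    obtain ⟨y, hy⟩ := U.nonempty_of_mem hA
    exact ⟨fun _ => y, y, fun _ => hy, hy, by simp⟩
  | succ k ih =>
    have hmul : ∀ᶠ y in (U : Filter M), ∀ᶠ z in (U : Filter M), y * z ∈ A := by
      rw [← Ultrafilter.eventually_mul U U (· ∈ A), hU]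
      exact hA
    obtain ⟨x, s, hx, hs, hprod⟩ := ih (inter_mem hA hmul)
    obtain ⟨y, hyA, hsy⟩ := U.nonempty_of_mem (inter_mem hA hs.2)
    refine ⟨Fin.snoc x y, s * y, fun i => ?_, hsy, ?_⟩
    · refine Fin.lastCases ?_ (fun i => ?_) i
      · simpa using hyA
      · simpa using (hx i).1
    · rw [Fin.prod_univ_castSucc]
      simp [hprod]

/-- A set of positive integers contains an `n`-term sum if it contains some `a i`, `i : Fin n`,
together with their sum. -/
def ContainsSum (n : ℕ) (A : Set ℕ+) : Prop :=
  ∃ (a : Fin n → ℕ+) (s : ℕ+), (∀ i, a i ∈ A) ∧ s ∈ A ∧ (s : ℕ) = ∑ i, (a i : ℕ)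

/-- Some multiplicatively idempotent ultrafilter on the positive integers has only members
containing `n`-term sums. -/
theorem exists_mul_self_forall_containsSum {n : ℕ} (hn : 1 ≤ n) :
    ∃ U : Ultrafilter ℕ+, (∀ A ∈ U, ContainsSum n A) ∧ U * U = U := by
  obtain ⟨k, rfl⟩ := Nat.exists_eq_add_of_le' hn
  refine exists_idempotent_in_compact_subsemigroup Ultrafilter.continuous_mul_left
    {U : Ultrafilter ℕ+ | ∀ A ∈ U, ContainsSum (k + 1) A} ?_ ?_ ?_
  · obtain ⟨U, hU⟩ := exists_idempotent_of_compact_t2_of_continuous_add_left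
      (Ultrafilter.continuous_add_left (M := ℕ+))
    exact ⟨U, fun A hA => Ultrafilter.exists_sum_mem_of_add_self PNat.coeAddHom hU k hA⟩
  · refine IsClosed.isCompact ?_
    simp only [Set.ofPred_forall]
    refine isClosed_iInter fun A => ?_
    by_cases hA : ContainsSum (k + 1) A
    · simp [hA]
    · simpa [hA, Set.compl_ofPred] using (ultrafilter_isOpen_basic A).isClosed_compl
  · intro U _ V hV A hA
    have hmul : ∀ᶠ y in (U : Filter ℕ+), ∀ᶠ z in (V : Filter ℕ+), y * z ∈ A :=
      (Ultrafilter.eventually_mul U V (· ∈ A)).1 hA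
    obtain ⟨y, hy⟩ := hmul.exists
    obtain ⟨a, s, ha, hs, hsum⟩ := hV _ hy
    exact ⟨fun i => y * a i, y * s, ha, hs, by simp [hsum, Finset.mul_sum]⟩

/-- For all positive integers `r, m, n`, any `r`-coloring of the positive integers
contains monochromatic `a_1, ..., a_n, x_1, ..., x_m` together with the common value
`a_1 + ... + a_n = x_1 * ... * x_m`. -/
theorem stmt_6 (r m n : ℕ) (hr : 1 ≤ r) (hm : 1 ≤ m) (hn : 1 ≤ n)
    (c : ℕ+ → Fin r) :
    ∃ (a : Fin n → ℕ+) (x : Fin m → ℕ+) (s : ℕ+),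
      (s : ℕ) = (∑ i, (a i : ℕ)) ∧
      (s : ℕ) = (∏ j, (x j : ℕ)) ∧
      (∀ i, c (a i) = c s) ∧ (∀ j, c (x j) = c s) := by
  obtain ⟨U, hsums, hU⟩ := exists_mul_self_forall_containsSum hn
  obtain ⟨b, hb⟩ := (Ultrafilter.eventually_exists_iff (f := U) (P := fun b y => c y = b)).1
    (.of_forall fun y => ⟨c y, rfl⟩)
  have hmul : ∀ᶠ y in (U : Filter ℕ+), ∀ᶠ z in (U : Filter ℕ+), c (y * z) = b := by
    rw [← Ultrafilter.eventually_mul U U (c · = b), hU]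
    exact hb
  obtain ⟨a, s, ha, hs, hsum⟩ := hsums _ (inter_mem hb hmul)
  obtain rfl | ⟨k, rfl⟩ : m = 1 ∨ ∃ k, m = k + 1 + 1 := by
    rcases m with _ | _ | k <;> simp at hm ⊢
  · exact ⟨a, fun _ => s, s, hsum, by simp, fun i => (ha i).1.trans hs.1.symm, fun _ => rfl⟩
  · have hdil : ∀ᶠ z in (U : Filter ℕ+), c z = b ∧ c (s * z) = b ∧ ∀ i, c (a i * z) = b :=
      Eventually.and hb (hs.2.and (eventually_all.2 fun i => (ha i).2))
    obtain ⟨x, y, hx, hy, hprod⟩ :=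
      Ultrafilter.exists_prod_mem_of_mul_self (PNat.coeMonoidHom : ℕ+ →ₙ* ℕ) hU k hdil
    refine ⟨fun i => a i * y, Fin.cons s x, s * y, ?_, ?_, fun i => ?_, fun j => ?_⟩
    · simp [hsum, Finset.sum_mul]
    · rw [Fin.prod_univ_succ]
      simpa using hprod
    · exact (hy.2.2 i).trans hy.2.1.symm
    · refine Eq.trans ?_ hy.2.1.symm
      refine Fin.cases ?_ (fun j => ?_) j
      · simpa using hs.1
      · simpa using (hx j).1
end

section
/- Let r ≥ 1 and S ≥ 2 be integers. Suppose there exists a coloring c_+ : {1, ..., S-1} → Fin r such that there are no positive integers a, b with a, b, a + b all in {1, ..., S-1} and c_+(a) = c_+(b) = c_+(a + b). Then there exists a coloring c_× : {2, ..., 2^(S-1)} → Fin r such that there are no integers x, y ≥ 2 with x, y, x * y all in {2, ..., 2^(S-1)} and c_×(x) = c_×(y) = c_×(x * y). In particular, the multiplicative Schur number S_×(r) satisfies S_×(r) ≥ 2^(S_+(r) - 1), where S_+(r) is the (additive) Schur number. -/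
open ArithmeticFunction in
theorem two_pow_cardFactors_le {n : ℕ} (hn : n ≠ 0) : 2 ^ cardFactors n ≤ n := by
  have h := List.pow_card_le_prod n.primeFactorsList 2
    fun p hp => (Nat.prime_of_mem_primeFactorsList hp).two_le
  rwa [Nat.prod_primeFactorsList hn] at h

open ArithmeticFunction in
theorem cardFactors_le_of_le_two_pow {n k : ℕ} (hn : n ≠ 0) (h : n ≤ 2 ^ k) :
    cardFactors n ≤ k :=
  (Nat.pow_le_pow_iff_right one_lt_two).mp ((two_pow_cardFactors_le hn).trans h)

/-- If there is an `r`-coloring of `{1, ..., S-1}` with no monochromatic additive Schur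
triple `{a, b, a+b}`, then there is an `r`-coloring of `{2, ..., 2^(S-1)}` with no
monochromatic multiplicative triple `{x, y, xy}`; hence `S_×(r) ≥ 2^(S_+(r) - 1)`. -/
theorem stmt_7 (r S : ℕ) (hr : 1 ≤ r) (hS : 2 ≤ S)
    (cplus : ℕ → Fin r)
    (hplus : ¬ ∃ a b : ℕ, 0 < a ∧ 0 < b ∧
      a ≤ S - 1 ∧ b ≤ S - 1 ∧ a + b ≤ S - 1 ∧
      cplus a = cplus b ∧ cplus a = cplus (a + b)) :
    ∃ ctimes : ℕ → Fin r,
      ¬ ∃ x y : ℕ, 2 ≤ x ∧ 2 ≤ y ∧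
        x ≤ 2 ^ (S - 1) ∧ y ≤ 2 ^ (S - 1) ∧ x * y ≤ 2 ^ (S - 1) ∧
        ctimes x = ctimes y ∧ ctimes x = ctimes (x * y) := by
  refine ⟨fun n => cplus (ArithmeticFunction.cardFactors n), ?_⟩
  rintro ⟨x, y, hx, hy, hxS, hyS, hxyS, hxy, hxxy⟩
  have hx0 : x ≠ 0 := by omega
  have hy0 : y ≠ 0 := by omega
  have hmul := ArithmeticFunction.cardFactors_mul hx0 hy0
  refine hplus ⟨_, _, ArithmeticFunction.cardFactors_pos_iff_one_lt.mpr hx,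
    ArithmeticFunction.cardFactors_pos_iff_one_lt.mpr hy,
    cardFactors_le_of_le_two_pow hx0 hxS, cardFactors_le_of_le_two_pow hy0 hyS, ?_, hxy, ?_⟩
  · exact hmul ▸ cardFactors_le_of_le_two_pow (mul_ne_zero hx0 hy0) hxyS
  · exact hmul ▸ hxxy
end

section
/- For every r ≥ 2 there exists a coloring c : {2, ..., 2^(2^r)} → Fin r such that there are no integers x, y ≥ 2 with x, y, x * y all in {2, ..., 2^(2^r)} and c(x) = c(y) = c(x * y). In particular, the multiplicative Schur number satisfies S_×(r) ≥ 2^(2^r). -/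
/-- The classical lower bound `S_+(r) > (3 ^ r - 1) / 2` for additive Schur numbers. -/
theorem exists_schur_coloring (r : ℕ) :
    ∃ c : ℕ → Fin (r + 1), ∀ x y : ℕ, 0 < x → 0 < y → 2 * (x + y) + 1 ≤ 3 ^ (r + 1) →
      c x = c y → c x ≠ c (x + y) := by
  induction r with
  | zero => exact ⟨fun _ => 0, fun x y hx hy h => by omega⟩
  | succ r ih =>
    obtain ⟨c, hc⟩ := ih
    refine ⟨fun m => if m % 3 = 1 then Fin.last _ else (c ((m + 1) / 3)).castSucc, ?_⟩
    intro x y hx hy h hxy hz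
    have hodd : 3 ^ (r + 1) % 2 = 1 := Nat.odd_iff.mp (Odd.pow (by decide))
    rw [pow_succ] at h
    dsimp only at hxy hz
    split_ifs at hxy hz <;>
      simp only [Fin.castSucc_inj, Fin.castSucc_ne_last, (Fin.castSucc_ne_last _).symm] at hxy hz
    · omega
    · have hsum : (x + y + 1) / 3 = (x + 1) / 3 + (y + 1) / 3 := by omega
      rw [hsum] at hz
      exact hc _ _ (by omega) (by omega) (by omega) hxy hz

theorem two_mul_two_pow_add_one_le_three_pow {r : ℕ} (hr : 2 ≤ r) : 2 * 2 ^ r + 1 ≤ 3 ^ r := by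
  induction r, hr using Nat.le_induction with
  | base => norm_num
  | succ r _ ih => rw [pow_succ, pow_succ]; omega

/-- For `r ≥ 2` there is an `r`-coloring of `{2, ..., 2^(2^r)}` with no monochromatic
multiplicative Schur triple `{x, y, xy}`; in particular `S_×(r) ≥ 2^(2^r)`. -/
theorem stmt_8 (r : ℕ) (hr : 2 ≤ r) :
    ∃ c : ℕ → Fin r,
      ¬ ∃ x y : ℕ, 2 ≤ x ∧ 2 ≤ y ∧
        x ≤ 2 ^ (2 ^ r) ∧ y ≤ 2 ^ (2 ^ r) ∧ x * y ≤ 2 ^ (2 ^ r) ∧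
        c x = c y ∧ c x = c (x * y) := by
  obtain ⟨s, rfl⟩ := Nat.exists_eq_add_of_le' (le_of_lt hr)
  obtain ⟨c, hc⟩ := exists_schur_coloring s
  refine ⟨fun n => c (ArithmeticFunction.cardFactors n), ?_⟩
  rintro ⟨x, y, hx, hy, -, -, hbound, hxy, hz⟩
  dsimp only at hxy hz
  have hx0 : x ≠ 0 := by omega
  have hy0 : y ≠ 0 := by omega
  have hle := (Nat.pow_le_pow_iff_right one_lt_two).mp
    ((two_pow_cardFactors_le (mul_ne_zero hx0 hy0)).trans hbound)
  have hthree := two_mul_two_pow_add_one_le_three_pow hr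
  rw [ArithmeticFunction.cardFactors_mul hx0 hy0] at hle hz
  exact hc _ _ (ArithmeticFunction.cardFactors_pos_iff_one_lt.mpr hx)
    (ArithmeticFunction.cardFactors_pos_iff_one_lt.mpr hy) (by omega) hxy hz
end

section
/- Let r, n ≥ 1 and let N be a positive integer such that every coloring of the unordered pairs from {1, ..., N} with r colors admits n+1 indices all of whose pairs receive the same color. Then for every coloring c : {1, ..., N} → Fin r there exist positive integers a_1, ..., a_n such that a_1, ..., a_n and a_1 + ... + a_n all lie in {1, ..., N} and all receive the same color under c. -/
/-- The consecutive differences of a monotone finite sequence of naturals telescope. -/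
theorem Fin.sum_succ_tsub_castSucc {n : ℕ} {e : Fin (n + 1) → ℕ} (he : Monotone e) :
    ∑ i : Fin n, (e i.succ - e i.castSucc) = e (Fin.last n) - e 0 := by
  induction n with
  | zero => simp
  | succ n ih =>
    have h := ih (e := fun i => e i.castSucc) (he.comp Fin.strictMono_castSucc.monotone)
    rw [Fin.sum_univ_castSucc]
    simp only [Fin.succ_castSucc, Fin.castSucc_zero, Fin.succ_last, Nat.succ_eq_add_one] at h ⊢
    rw [h]
    have h₀ : e 0 ≤ e (Fin.last n).castSucc := he (Fin.zero_le _)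
    have h₁ : e (Fin.last n).castSucc ≤ e (Fin.last (n + 1)) := he (Fin.le_last _)
    omega

/-- Generalized Schur theorem: if `N` has the `(n+1; r)`-Ramsey property for pairs,
then every `r`-coloring of `{1, ..., N}` contains positive integers `a_1, ..., a_n`
such that `a_1, ..., a_n` and `a_1 + ... + a_n` all lie in `{1, ..., N}` and are
monochromatic. -/
theorem stmt_9 (r n N : ℕ) (hr : 1 ≤ r) (hn : 1 ≤ n) (hN : 0 < N)
    (hRamsey : ∀ f : ℕ → ℕ → Fin r, ∃ T : Finset ℕ,
      T ⊆ Finset.Icc 1 N ∧ T.card = n + 1 ∧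
      ∀ i ∈ T, ∀ j ∈ T, ∀ i' ∈ T, ∀ j' ∈ T, i < j → i' < j' → f i j = f i' j')
    (c : ℕ → Fin r) :
    ∃ a : Fin n → ℕ,
      (∀ i, 0 < a i) ∧ (∀ i, a i ≤ N) ∧ (∑ i, a i) ≤ N ∧
      (∀ i, c (a i) = c (∑ i, a i)) := by
  obtain ⟨T, hT, hcard, hmono⟩ := hRamsey fun i j => c (j - i)
  let e := T.orderEmbOfFin hcard
  have hmem (i) : e i ∈ T := T.orderEmbOfFin_mem hcard i
  have hle (i) : e i ≤ N := (Finset.mem_Icc.mp (hT (hmem i))).2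
  have hlt (i : Fin n) : e i.castSucc < e i.succ := e.strictMono Fin.castSucc_lt_succ
  have hlast : e 0 < e (Fin.last n) := e.strictMono (Fin.lt_def.mpr hn)
  refine ⟨fun i => e i.succ - e i.castSucc, fun i => Nat.sub_pos_of_lt (hlt i),
    fun i => (Nat.sub_le _ _).trans (hle _), ?_, fun i => ?_⟩
  · rw [Fin.sum_succ_tsub_castSucc e.monotone]
    exact (Nat.sub_le _ _).trans (hle _)
  · rw [Fin.sum_succ_tsub_castSucc e.monotone]
    exact hmono _ (hmem _) _ (hmem _) _ (hmem _) _ (hmem _) (hlt i) hlast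
end
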